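/- arXiv:2004.01304 — 3 statements merged into one kernel-verified Lean document; each statement's English description precedes it below -/
import Mathlib

section
/- Let κ, D, r > 0 and let (L_t)_{t=0,...,n} be positive reals satisfying L_t ≤ √(κ·D·r·L_{t−1}) for every 1 ≤ t ≤ n. Then L_n ≤ (κDr)^{(2ⁿ−1)/2ⁿ} · L₀^{1/2ⁿ}. Moreover, if L₀ ≤ κDr, then L_t ≤ κDr for every 0 ≤ t ≤ n, and consequently the price Z_t := D/L_t satisfies Z_t ≥ 1/(κr) for every 0 ≤ t ≤ n. (Proposition 5 of the paper: in the stable domain the stablecoin price stays within explicit bounds.) -/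
theorem le_rpow_mul_rpow_of_le_sqrt_mul {c : ℝ} (hc : 0 < c) {L : ℕ → ℝ} (h0 : 0 ≤ L 0) (n : ℕ)
    (hrec : ∀ t < n, L (t + 1) ≤ √(c * L t)) :
    L n ≤ c ^ (((2 : ℝ) ^ n - 1) / (2 : ℝ) ^ n) * L 0 ^ ((1 : ℝ) / (2 : ℝ) ^ n) := by
  induction n with
  | zero => simp
  | succ k ih =>
    have ihk := ih fun t ht => hrec t (ht.trans k.lt_succ_self)
    have hexp : ((2 : ℝ) ^ (k + 1) - 1) / (2 : ℝ) ^ (k + 1)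
        = (1 + ((2 : ℝ) ^ k - 1) / (2 : ℝ) ^ k) * (1 / 2) := by
      field_simp
      ring
    have hexp' : (1 : ℝ) / (2 : ℝ) ^ (k + 1) = 1 / (2 : ℝ) ^ k * (1 / 2) := by
      field_simp
      ring
    calc L (k + 1) ≤ √(c * L k) := hrec k k.lt_succ_self
      _ ≤ √(c * (c ^ (((2 : ℝ) ^ k - 1) / (2 : ℝ) ^ k) * L 0 ^ ((1 : ℝ) / (2 : ℝ) ^ k))) := by
        gcongr
      _ = _ := by
        rw [hexp, hexp', Real.rpow_mul hc.le, Real.rpow_mul h0, Real.rpow_add hc, Real.rpow_one,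
          ← Real.mul_rpow (by positivity) (by positivity), ← Real.sqrt_eq_rpow, mul_assoc]

theorem le_of_le_sqrt_mul {c : ℝ} (hc : 0 ≤ c) {L : ℕ → ℝ} (h0 : L 0 ≤ c) (n : ℕ)
    (hrec : ∀ t < n, L (t + 1) ≤ √(c * L t)) : L n ≤ c := by
  induction n with
  | zero => exact h0
  | succ k ih =>
    have ihk := ih fun t ht => hrec t (ht.trans k.lt_succ_self)
    calc L (k + 1) ≤ √(c * L k) := hrec k k.lt_succ_self
      _ ≤ √(c * c) := by gcongr
      _ = c := Real.sqrt_mul_self hc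

/-- Proposition 5 of the paper: in the stable domain the stablecoin supply and
price stay within explicit bounds. -/
theorem stmt_6 (κ D r : ℝ) (hκ : 0 < κ) (hD : 0 < D) (hr : 0 < r)
    (n : ℕ) (L : ℕ → ℝ) (hLpos : ∀ t ≤ n, 0 < L t)
    (hrec : ∀ t, 1 ≤ t → t ≤ n → L t ≤ Real.sqrt (κ * D * r * L (t - 1))) :
    L n ≤ (κ * D * r) ^ (((2 : ℝ) ^ n - 1) / (2 : ℝ) ^ n) * (L 0) ^ ((1 : ℝ) / (2 : ℝ) ^ n) ∧
    (L 0 ≤ κ * D * r → ∀ t ≤ n, L t ≤ κ * D * r ∧ 1 / (κ * r) ≤ D / L t) := by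
  have hc : 0 < κ * D * r := by positivity
  have hrec' : ∀ t < n, L (t + 1) ≤ √(κ * D * r * L t) := fun t ht =>
    hrec (t + 1) t.succ_pos ht
  refine ⟨le_rpow_mul_rpow_of_le_sqrt_mul hc (hLpos 0 n.zero_le).le n hrec', fun h0 t ht => ?_⟩
  have hLt := le_of_le_sqrt_mul hc.le h0 t fun s hs => hrec' s (hs.trans_le ht)
  refine ⟨hLt, ?_⟩
  rw [div_le_div_iff₀ (by positivity) (hLpos t ht)]
  linarith
end

section
/- Let (Ω, 𝓕, P) be a probability space, 𝓖 ⊆ 𝓗 ⊆ 𝓕 sub-σ-algebras, κ, D > 0 constants, L a 𝓖-measurable random variable with L > 0 a.s., and R a nonnegative integrable random variable with E[R | 𝓗] > 0 a.s. and (E[R | 𝓗])^{−1/2} integrable. If L′ is a random variable with 0 < L′ ≤ √(κ·D·L·E[R | 𝓗]) a.s., then E[ D/L′ | 𝓖 ] ≥ √( D / (κ·L·E[R | 𝓖]) ) a.s. (The conditional-expectation price bound of Proposition 7, proved via the upper bound on supply, conditional Jensen's inequality applied to the convex map x ↦ x^{−1/2}, and the tower property.) -/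
open MeasureTheory

/-- Conditional Jensen's inequality for the convex function `x ↦ x ^ (-1 / 2)` on `(0, ∞)`, which
`ConvexOn.map_condExp_le` does not cover because the half-line is not closed. -/
theorem condExp_rpow_neg_half_le {Ω : Type*} {m m0 : MeasurableSpace Ω} {μ : Measure Ω}
    [IsFiniteMeasure μ] (hm : m ≤ m0) {X : Ω → ℝ} (hX_pos : ∀ᵐ ω ∂μ, 0 < X ω)
    (hX : Integrable X μ) (hX' : Integrable (fun ω => X ω ^ (-(1 : ℝ) / 2)) μ) :
    ∀ᵐ ω ∂μ, (μ[X | m]) ω ^ (-(1 : ℝ) / 2) ≤ (μ[fun ω' => X ω' ^ (-(1 : ℝ) / 2) | m]) ω := by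
  have rpow_sq {x : ℝ} (hx : 0 < x) : (x ^ (-(1 : ℝ) / 2)) ^ 2 * x = 1 := by
    rw [← Real.rpow_natCast, ← Real.rpow_mul hx.le]
    norm_num
    rw [Real.rpow_neg_one, inv_mul_cancel₀ hx.ne']
  have tangent (q : ℚ) : ∀ᵐ ω ∂μ, 3 / 2 * |(q : ℝ)| - 1 / 2 * |(q : ℝ)| ^ 3 * (μ[X | m]) ω ≤
      (μ[fun ω' => X ω' ^ (-(1 : ℝ) / 2) | m]) ω := by
    set b : ℝ := |(q : ℝ)|
    have hb : 0 ≤ b := abs_nonneg _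
    have hmono : μ[(fun _ => 3 / 2 * b) - (1 / 2 * b ^ 3) • X | m] ≤ᵐ[μ]
        μ[fun ω' => X ω' ^ (-(1 : ℝ) / 2) | m] := by
      refine condExp_mono ((integrable_const _).sub (hX.smul _)) hX' ?_
      filter_upwards [hX_pos] with ω hω
      have hy : 0 < X ω ^ (-(1 : ℝ) / 2) := Real.rpow_pos_of_pos hω _
      have hyX := rpow_sq hω
      simp only [Pi.sub_apply, Pi.smul_apply, smul_eq_mul]
      set y := X ω ^ (-(1 : ℝ) / 2)
      have hmul : 0 ≤ X ω * ((y - b) ^ 2 * (2 * y + b)) := by positivity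
      have hexp : X ω * ((y - b) ^ 2 * (2 * y + b)) =
          2 * y * (y ^ 2 * X ω) - 3 * b * (y ^ 2 * X ω) + b ^ 3 * X ω := by ring
      rw [hexp, hyX] at hmul
      linarith
    have hsub := condExp_sub (m := m) (integrable_const (μ := μ) (3 / 2 * b))
      (hX.smul (1 / 2 * b ^ 3))
    filter_upwards [hmono, hsub, condExp_smul (μ := μ) (1 / 2 * b ^ 3) X m] with ω h₁ h₂ h₃
    rw [h₂, Pi.sub_apply, h₃, condExp_const hm] at h₁
    simpa using h₁
  have hnonneg : 0 ≤ᵐ[μ] μ[X | m] := condExp_nonneg (hX_pos.mono fun _ h => h.le)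
  filter_upwards [ae_all_iff.2 tangent, hnonneg] with ω hω hg
  set g := (μ[X | m]) ω
  have hall (b : ℝ) : 3 / 2 * |b| - 1 / 2 * |b| ^ 3 * g ≤
      (μ[fun ω' => X ω' ^ (-(1 : ℝ) / 2) | m]) ω :=
    Rat.denseRange_cast.induction_on b (isClosed_le (by fun_prop) continuous_const) hω
  rcases (show 0 ≤ g from hg).eq_or_lt with h0 | hpos
  · rw [← h0, Real.zero_rpow (by norm_num)]
    simpa using hall 0
  · have hb := hall (g ^ (-(1 : ℝ) / 2))
    rw [abs_of_pos (Real.rpow_pos_of_pos hpos _)] at hb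
    have hbg := rpow_sq hpos
    set b := g ^ (-(1 : ℝ) / 2)
    have hcube : 1 / 2 * b ^ 3 * g = 1 / 2 * b * (b ^ 2 * g) := by ring
    rw [hcube, hbg] at hb
    linarith

/-- The conditional-expectation price bound of Proposition 7: if the new supply L'
satisfies 0 < L' ≤ √(κ·D·L·E[R|𝓗]), then E[D/L' | 𝓖] ≥ √(D/(κ·L·E[R|𝓖])). -/
theorem stmt_8 {Ω : Type*} {m0 : MeasurableSpace Ω} (μ : Measure Ω)
    [IsProbabilityMeasure μ] (𝓖 𝓗 : MeasurableSpace Ω)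
    (h𝓖𝓗 : 𝓖 ≤ 𝓗) (h𝓗 : 𝓗 ≤ m0)
    (κ D : ℝ) (hκ : 0 < κ) (hD : 0 < D)
    (L : Ω → ℝ) (hL_meas : Measurable[𝓖] L) (hL_pos : ∀ᵐ ω ∂μ, 0 < L ω)
    (R : Ω → ℝ) (hR_nonneg : 0 ≤ᵐ[μ] R) (hR_int : Integrable R μ)
    (hcond_pos : ∀ᵐ ω ∂μ, 0 < (μ[R | 𝓗]) ω)
    (hcond_int : Integrable (fun ω => ((μ[R | 𝓗]) ω) ^ (-(1 : ℝ) / 2)) μ)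
    (L' : Ω → ℝ)
    (hL' : ∀ᵐ ω ∂μ, 0 < L' ω ∧ L' ω ≤ Real.sqrt (κ * D * L ω * (μ[R | 𝓗]) ω))
    (hint : Integrable (fun ω => D / L' ω) μ) :
    ∀ᵐ ω ∂μ, Real.sqrt (D / (κ * L ω * (μ[R | 𝓖]) ω)) ≤ (μ[fun ω' => D / L' ω' | 𝓖]) ω := by
  have h𝓖 := h𝓖𝓗.trans h𝓗
  have rpow_eq {x : ℝ} (hx : 0 ≤ x) : x ^ (-(1 : ℝ) / 2) = (√x)⁻¹ := by
    rw [neg_div, Real.rpow_neg hx, Real.sqrt_eq_rpow]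
  set c : Ω → ℝ := fun ω => √(D / (κ * L ω))
  set f : Ω → ℝ := fun ω => (μ[R | 𝓗]) ω ^ (-(1 : ℝ) / 2)
  have hc : StronglyMeasurable[𝓖] c :=
    (Real.continuous_sqrt.measurable.comp
      (measurable_const.div (measurable_const.mul hL_meas))).stronglyMeasurable
  have hle : c * f ≤ᵐ[μ] fun ω => D / L' ω := by
    filter_upwards [hL_pos, hcond_pos, hL'] with ω hL hX hω
    simp only [c, f, Pi.mul_apply]
    rw [rpow_eq hX.le, ← Real.sqrt_inv, ← Real.sqrt_mul (by positivity)]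
    calc √(D / (κ * L ω) * ((μ[R | 𝓗]) ω)⁻¹)
        = √(D ^ 2 / (κ * D * L ω * (μ[R | 𝓗]) ω)) := by
          congr 1
          field_simp
      _ = D / √(κ * D * L ω * (μ[R | 𝓗]) ω) := by
          rw [Real.sqrt_div (by positivity), Real.sqrt_sq hD.le]
      _ ≤ D / L' ω := div_le_div_of_nonneg_left hD.le hω.1 hω.2
  have hcf : Integrable (c * f) μ := by
    refine hint.mono ((hc.mono h𝓖).aestronglyMeasurable.mul hcond_int.aestronglyMeasurable) ?_
    filter_upwards [hle, hcond_pos] with ω hω hX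
    have hnonneg : 0 ≤ (c * f) ω :=
      mul_nonneg (Real.sqrt_nonneg _) (Real.rpow_nonneg hX.le _)
    rw [Real.norm_of_nonneg hnonneg]
    exact hω.trans (le_abs_self _)
  filter_upwards [condExp_mono (m := 𝓖) hcf hint hle,
    condExp_mul_of_stronglyMeasurable_left hc hcf hcond_int,
    condExp_rpow_neg_half_le h𝓖 hcond_pos integrable_condExp hcond_int,
    condExp_condExp_of_le (μ := μ) (f := R) h𝓖𝓗 h𝓗, hL_pos,
    condExp_nonneg (m := 𝓖) hR_nonneg] with ω hmono hpull hjensen htower hL hg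
  rw [htower, rpow_eq hg] at hjensen
  calc √(D / (κ * L ω * (μ[R | 𝓖]) ω)) = c ω * (√((μ[R | 𝓖]) ω))⁻¹ := by
        rw [← div_div, Real.sqrt_div (by positivity), div_eq_mul_inv]
    _ ≤ c ω * (μ[f | 𝓖]) ω := mul_le_mul_of_nonneg_left hjensen (Real.sqrt_nonneg _)
    _ = (μ[c * f | 𝓖]) ω := hpull.symm
    _ ≤ (μ[fun ω' => D / L' ω' | 𝓖]) ω := hmono
end

section
/- Let D, γ, r be positive reals with r ≥ 1, let (ρ_t)_{t≥1} be a sequence of reals with 1 ≤ ρ_t ≤ r for all t, and let L₀ satisfy 0 < L₀ ≤ γD. Define recursively L_t := √(γ·D·ρ_t·L_{t−1}) for t ≥ 1. Then for every t ≥ 0: L₀ ≤ L_t ≤ γDr; equivalently, the price Z_t := D/L_t satisfies 1/(γr) ≤ Z_t ≤ Z₀, where Z₀ = D/L₀. (The paper's 'unlimited speculator supply' stability claim: with infinite speculator depth, marginal profitability zero forces L_t = √(γDL_{t−1}E[R_{t+1}|𝓕_t]), and under submartingale ETH returns the stablecoin price is confined to the small range [1/(γr), Z₀].) -/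
/-- The paper's 'unlimited speculator supply' stability claim: with infinite
speculator depth, marginal profitability zero forces L_t = √(γDρ_tL_{t−1}), and
under submartingale ETH returns (1 ≤ ρ_t ≤ r) the stablecoin price Z_t = D/L_t is
confined to the range [1/(γr), Z₀]. -/
theorem stmt_15 (D γ r : ℝ) (hD : 0 < D) (hγ : 0 < γ) (hr : 1 ≤ r)
    (ρ : ℕ → ℝ) (hρ : ∀ t, 1 ≤ t → 1 ≤ ρ t ∧ ρ t ≤ r)
    (L : ℕ → ℝ) (hL0_pos : 0 < L 0) (hL0 : L 0 ≤ γ * D)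
    (hLrec : ∀ t, 1 ≤ t → L t = Real.sqrt (γ * D * ρ t * L (t - 1))) :
    ∀ t : ℕ, (L 0 ≤ L t ∧ L t ≤ γ * D * r) ∧
      (1 / (γ * r) ≤ D / L t ∧ D / L t ≤ D / L 0) := by
  have hγD : 0 < γ * D := mul_pos hγ hD
  have hr0 : 0 < r := by linarith
  have hbounds : ∀ t, L 0 ≤ L t ∧ L t ≤ γ * D * r := by
    intro t
    induction t with
    | zero => exact ⟨le_rfl, hL0.trans (le_mul_of_one_le_right hγD.le hr)⟩
    | succ t ih =>
      obtain ⟨hlow, hupp⟩ := ih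
      obtain ⟨hρ1, hρr⟩ := hρ (t + 1) (Nat.le_add_left 1 t)
      have hLt : 0 < L t := hL0_pos.trans_le hlow
      rw [hLrec (t + 1) (Nat.le_add_left 1 t), Nat.add_sub_cancel]
      constructor
      · apply Real.le_sqrt_of_sq_le
        calc L 0 ^ 2 = L 0 * L 0 := sq _
          _ ≤ γ * D * ρ (t + 1) * L t :=
            mul_le_mul (hL0.trans (le_mul_of_one_le_right hγD.le hρ1)) hlow
              hL0_pos.le (by positivity)
      · apply Real.sqrt_le_iff.mpr
        refine ⟨by positivity, ?_⟩
        calc γ * D * ρ (t + 1) * L t ≤ γ * D * r * (γ * D * r) :=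
            mul_le_mul (mul_le_mul_of_nonneg_left hρr hγD.le) hupp hLt.le (by positivity)
          _ = (γ * D * r) ^ 2 := (sq _).symm
  intro t
  obtain ⟨hlow, hupp⟩ := hbounds t
  have hLt : 0 < L t := hL0_pos.trans_le hlow
  refine ⟨⟨hlow, hupp⟩, ?_, div_le_div_of_nonneg_left hD.le hL0_pos hlow⟩
  rw [div_le_div_iff₀ (by positivity) hLt]
  linarith
end
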